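/- Let d ≥ 1 and n ≥ 1 be integers and let 0 < α < 1. There exist positive constants A = A(n,d,α) and B = B(n,d,α), depending only on n, d and α, such that for every triple of pairwise distinct points x, y, z ∈ ℝ^d one has A / L(x,y,z)^{2α} ≤ p_{α,n}(x,y,z) ≤ B / L(x,y,z)^{2α}. -/

import Mathlib

open scoped BigOperators

/-- The kernel `K^i_{α,n}(x) = x_i^{2n-1} / |x|^{2n-1+α}`. -/
noncomputable def Kker (d n : ℕ) (α : ℝ) (i : Fin d) (x : EuclideanSpace ℝ (Fin d)) : ℝ :=
  (x i) ^ (2 * n - 1) / ‖x‖ ^ (2 * (n : ℝ) - 1 + α)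

/-- The symmetrization (permutation) `p^i_{α,n}(x,y,z)`. -/
noncomputable def permI (d n : ℕ) (α : ℝ) (i : Fin d)
    (x y z : EuclideanSpace ℝ (Fin d)) : ℝ :=
  Kker d n α i (x - y) * Kker d n α i (x - z) +
    Kker d n α i (y - x) * Kker d n α i (y - z) +
    Kker d n α i (z - x) * Kker d n α i (z - y)

/-- `p_{α,n}(x,y,z) = Σ_{i=1}^d p^i_{α,n}(x,y,z)`. -/
noncomputable def permTot (d n : ℕ) (α : ℝ) (x y z : EuclideanSpace ℝ (Fin d)) : ℝ :=
  ∑ i : Fin d, permI d n α i x y z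

/-- `L(x,y,z)`: the length of the longest side of the triangle with vertices `x, y, z`. -/
noncomputable def Ltri (d : ℕ) (x y z : EuclideanSpace ℝ (Fin d)) : ℝ :=
  max ‖x - y‖ (max ‖y - z‖ ‖x - z‖)

lemma Kker_neg (d n : ℕ) (hn : 1 ≤ n) (α : ℝ) (i : Fin d) (x : EuclideanSpace ℝ (Fin d)) :
    Kker d n α i (-x) = -Kker d n α i x := by
  have hodd : Odd (2 * n - 1) := ⟨n - 1, by omega⟩
  simp [Kker, hodd.neg_pow, neg_div]

lemma permI_eq (d n : ℕ) (hn : 1 ≤ n) (α : ℝ) (i : Fin d) (x y z : EuclideanSpace ℝ (Fin d)) :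
    permI d n α i x y z = Kker d n α i (x - y) * Kker d n α i (x - z) +
      Kker d n α i (y - z) * Kker d n α i (x - z) -
      Kker d n α i (x - y) * Kker d n α i (y - z) := by
  rw [permI, ← neg_sub x y, ← neg_sub x z, ← neg_sub y z]
  simp only [Kker_neg d n hn]
  ring

lemma permI_swap_left (d n : ℕ) (α : ℝ) (i : Fin d) (x y z : EuclideanSpace ℝ (Fin d)) :
    permI d n α i y x z = permI d n α i x y z := by
  simp only [permI]; ring

lemma permI_swap_right (d n : ℕ) (α : ℝ) (i : Fin d) (x y z : EuclideanSpace ℝ (Fin d)) :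
    permI d n α i x z y = permI d n α i x y z := by
  simp only [permI]; ring

lemma Ltri_swap_left (d : ℕ) (x y z : EuclideanSpace ℝ (Fin d)) :
    Ltri d y x z = Ltri d x y z := by
  simp only [Ltri, norm_sub_rev y x, max_comm ‖x - z‖]

lemma Ltri_swap_right (d : ℕ) (x y z : EuclideanSpace ℝ (Fin d)) :
    Ltri d x z y = Ltri d x y z := by
  simp only [Ltri, norm_sub_rev z y]
  rw [max_comm, max_assoc, max_comm, max_assoc, max_comm ‖x - z‖]

/-- Convexity estimate behind the positivity of the permutations. -/
lemma pow_mul_rpow_add_le (m : ℕ) (hm : 1 ≤ m) {α a b A B C : ℝ} (hα0 : 0 < α) (hα1 : α < 1)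
    (ha : 0 < a) (hab : a ≤ b) (haA : a ≤ A) (hbB : b ≤ B) (hC0 : 0 ≤ C) (hC : C ≤ A + B) :
    a ^ m * b ^ m * C ^ (m + α) ≤ (a + b) ^ m *
      ((1 / 2 : ℝ) ^ (1 - α) * (b ^ m * A ^ (m + α)) + a ^ m * B ^ (m + α)) := by
  have hb : 0 < b := ha.trans_le hab
  have hA : 0 < A := ha.trans_le haA
  have hB : 0 < B := hb.trans_le hbB
  have hc : 0 < a + b := by positivity
  have hm' : (1 : ℝ) ≤ m := by exact_mod_cast hm
  have hs : 0 < m + α := by linarith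
  have hconv := (convexOn_rpow (show (1 : ℝ) ≤ m + α by linarith)).2
    (Set.mem_Ici.2 (div_pos hA ha).le) (Set.mem_Ici.2 (div_pos hB hb).le)
    (div_pos ha hc).le (div_pos hb hc).le (by field_simp)
  simp only [smul_eq_mul] at hconv
  have hmean : a / (a + b) * (A / a) + b / (a + b) * (B / b) = (A + B) / (a + b) := by
    field_simp
  have hsplit : ∀ u : ℝ, 0 < u → u ^ (m + α) = u ^ m * u ^ α := fun u hu => by
    rw [Real.rpow_add hu, Real.rpow_natCast]
  have hcompl : ∀ u : ℝ, 0 < u → u = u ^ α * u ^ (1 - α) := fun u hu => by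
    rw [← Real.rpow_add hu]; simp
  rw [hmean, Real.div_rpow (by positivity) hc.le, Real.div_rpow hA.le ha.le,
    Real.div_rpow hB.le hb.le, div_le_iff₀ (by positivity)] at hconv
  have hpow : C ^ (m + α) ≤ (A + B) ^ (m + α) := Real.rpow_le_rpow hC0 hC hs.le
  have hratio : ∀ u : ℝ, 0 < u →
      u / (a + b) / u ^ α * (a + b) ^ α = (u / (a + b)) ^ (1 - α) := fun u hu => by
    rw [Real.div_rpow hu.le hc.le]
    have h1 := hcompl u hu
    have h2 := hcompl _ hc
    have := Real.rpow_pos_of_pos hu α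
    have := Real.rpow_pos_of_pos hc α
    have := Real.rpow_pos_of_pos hc (1 - α)
    rw [div_div, div_mul_eq_mul_div, div_eq_div_iff (by positivity) (by positivity)]
    linear_combination ((a + b) ^ α * (a + b) ^ (1 - α)) * h1 - (u ^ α * u ^ (1 - α)) * h2
  have hra : (a / (a + b)) ^ (1 - α) ≤ (1 / 2 : ℝ) ^ (1 - α) :=
    Real.rpow_le_rpow (by positivity) (by rw [div_le_div_iff₀ hc two_pos]; linarith)
      (by linarith)
  have hrb : (b / (a + b)) ^ (1 - α) ≤ 1 :=
    Real.rpow_le_one (by positivity) (by rw [div_le_one hc]; linarith) (by linarith)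
  calc a ^ m * b ^ m * C ^ (m + α)
      ≤ a ^ m * b ^ m * ((a / (a + b) * (A ^ (m + α) / a ^ (m + α)) +
          b / (a + b) * (B ^ (m + α) / b ^ (m + α))) * (a + b) ^ (m + α)) := by
        gcongr; exact hpow.trans hconv
    _ = (a + b) ^ m * ((a / (a + b)) ^ (1 - α) * (b ^ m * A ^ (m + α)) +
          (b / (a + b)) ^ (1 - α) * (a ^ m * B ^ (m + α))) := by
        rw [← hratio a ha, ← hratio b hb, hsplit a ha, hsplit b hb, hsplit _ hc]
        have := Real.rpow_pos_of_pos ha α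
        have := Real.rpow_pos_of_pos hb α
        field_simp
    _ ≤ (a + b) ^ m * ((1 / 2 : ℝ) ^ (1 - α) * (b ^ m * A ^ (m + α)) +
          1 * (a ^ m * B ^ (m + α))) := by gcongr
    _ = _ := by rw [one_mul]

/-- Lower bound for the permutation of three ordered real numbers with gaps `a ≤ b`. -/
lemma mul_le_perm_of_le (m : ℕ) (hm : 1 ≤ m) {α a b A B C : ℝ} (hα0 : 0 < α) (hα1 : α < 1)
    (ha : 0 ≤ a) (hab : a ≤ b) (haA : a ≤ A) (hbB : b ≤ B) (hA : 0 < A) (hB : 0 < B)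
    (hC0 : 0 < C) (hC : C ≤ A + B) :
    (1 - (1 / 2 : ℝ) ^ (1 - α)) * (b ^ m / B ^ (m + α) * ((a + b) ^ m / C ^ (m + α))) ≤
      a ^ m / A ^ (m + α) * ((a + b) ^ m / C ^ (m + α)) +
      b ^ m / B ^ (m + α) * ((a + b) ^ m / C ^ (m + α)) -
      a ^ m / A ^ (m + α) * (b ^ m / B ^ (m + α)) := by
  have hA' := Real.rpow_pos_of_pos hA (m + α)
  have hB' := Real.rpow_pos_of_pos hB (m + α)
  have hC' := Real.rpow_pos_of_pos hC0 (m + α)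
  have key : a ^ m * b ^ m * C ^ (m + α) ≤ (a + b) ^ m *
      ((1 / 2 : ℝ) ^ (1 - α) * (b ^ m * A ^ (m + α)) + a ^ m * B ^ (m + α)) := by
    rcases ha.eq_or_lt with rfl | ha
    · rw [zero_pow (by omega)]; simp only [zero_mul]; positivity
    · exact pow_mul_rpow_add_le m hm hα0 hα1 ha hab haA hbB hC0.le hC
  rw [← sub_nonneg]
  have : a ^ m / A ^ (m + α) * ((a + b) ^ m / C ^ (m + α)) +
      b ^ m / B ^ (m + α) * ((a + b) ^ m / C ^ (m + α)) -
      a ^ m / A ^ (m + α) * (b ^ m / B ^ (m + α)) -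
      (1 - (1 / 2 : ℝ) ^ (1 - α)) * (b ^ m / B ^ (m + α) * ((a + b) ^ m / C ^ (m + α))) =
      ((a + b) ^ m * ((1 / 2 : ℝ) ^ (1 - α) * (b ^ m * A ^ (m + α)) + a ^ m * B ^ (m + α)) -
        a ^ m * b ^ m * C ^ (m + α)) / (A ^ (m + α) * B ^ (m + α) * C ^ (m + α)) := by
    field_simp
    ring
  rw [this]
  exact div_nonneg (sub_nonneg.2 key) (by positivity)

/-- Quantitative form of `mul_le_perm_of_le` when the total gap is at least `ε L`. -/
lemma le_perm_of_le (m : ℕ) (hm : 1 ≤ m) {α a b A B C L ε : ℝ} (hα0 : 0 < α) (hα1 : α < 1)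
    (ha : 0 ≤ a) (hab : a ≤ b) (haA : a ≤ A) (hbB : b ≤ B) (hA : 0 < A) (hB : 0 < B)
    (hC0 : 0 < C) (hC : C ≤ A + B) (hBL : B ≤ L) (hCL : C ≤ L) (hε : 0 ≤ ε)
    (hεL : ε * L ≤ a + b) :
    (1 - (1 / 2 : ℝ) ^ (1 - α)) * (ε / 2) ^ (2 * m) / L ^ (2 * α) ≤
      a ^ m / A ^ (m + α) * ((a + b) ^ m / C ^ (m + α)) +
      b ^ m / B ^ (m + α) * ((a + b) ^ m / C ^ (m + α)) -
      a ^ m / A ^ (m + α) * (b ^ m / B ^ (m + α)) := by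
  refine le_trans ?_ (mul_le_perm_of_le m hm hα0 hα1 ha hab haA hbB hA hB hC0 hC)
  have hL : 0 < L := hB.trans_le hBL
  have hδ : 0 ≤ 1 - (1 / 2 : ℝ) ^ (1 - α) :=
    sub_nonneg.2 (Real.rpow_le_one (by norm_num) (by norm_num) (by linarith))
  rw [mul_div_assoc]
  refine mul_le_mul_of_nonneg_left ?_ hδ
  have hkernel : ∀ u U : ℝ, 0 < U → U ≤ L → ε / 2 * L ≤ u →
      (ε / 2) ^ m / L ^ α ≤ u ^ m / U ^ (m + α) := fun u U hU hUL hu => by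
    have h1 : (ε / 2) ^ m / L ^ α = (ε / 2 * L) ^ m / L ^ (m + α) := by
      rw [Real.rpow_add hL, Real.rpow_natCast, mul_pow]
      have := Real.rpow_pos_of_pos hL α
      field_simp
    rw [h1]
    have := Real.rpow_pos_of_pos hU (m + α)
    have hu' : (ε / 2 * L) ^ m ≤ u ^ m := pow_le_pow_left₀ (by positivity) hu m
    have hpow : 0 ≤ u ^ m := (by positivity : 0 ≤ (ε / 2 * L) ^ m).trans hu'
    gcongr
  have hb : ε / 2 * L ≤ b := by linarith
  calc (ε / 2) ^ (2 * m) / L ^ (2 * α)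
      = (ε / 2) ^ m / L ^ α * ((ε / 2) ^ m / L ^ α) := by
        rw [div_mul_div_comm, ← Real.rpow_add hL, ← pow_add, two_mul, two_mul]
    _ ≤ _ := mul_le_mul (hkernel b B hB hBL hb) (hkernel (a + b) C hC0 hCL (by linarith))
        (by positivity) (div_nonneg (pow_nonneg (ha.trans hab) m) (by positivity))

/-- The lower bound for points whose `i`-th coordinates are sorted. -/
lemma le_permI_of_sorted (d n : ℕ) (hn : 1 ≤ n) {α ε : ℝ} (hα0 : 0 < α) (hα1 : α < 1)
    (hε : 0 ≤ ε) (i : Fin d) {x y z : EuclideanSpace ℝ (Fin d)}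
    (hxy : x ≠ y) (hyz : y ≠ z) (hxz : x ≠ z) (h₁ : y i ≤ x i) (h₂ : z i ≤ y i)
    (hεL : ε * Ltri d x y z ≤ x i - z i) :
    (1 - (1 / 2 : ℝ) ^ (1 - α)) * (ε / 2) ^ (2 * (2 * n - 1)) / (Ltri d x y z) ^ (2 * α) ≤
      permI d n α i x y z := by
  have hcast : 2 * (n : ℝ) - 1 + α = ((2 * n - 1 : ℕ) : ℝ) + α := by
    rw [Nat.cast_sub (by omega)]; push_cast; ring
  have hcoord : ∀ v : EuclideanSpace ℝ (Fin d), v i ≤ ‖v‖ := fun v =>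
    (le_abs_self _).trans (PiLp.norm_apply_le v i)
  have hA : 0 < ‖x - y‖ := norm_pos_iff.2 (sub_ne_zero.2 hxy)
  have hB : 0 < ‖y - z‖ := norm_pos_iff.2 (sub_ne_zero.2 hyz)
  have hC : 0 < ‖x - z‖ := norm_pos_iff.2 (sub_ne_zero.2 hxz)
  have htri : ‖x - z‖ ≤ ‖x - y‖ + ‖y - z‖ := norm_sub_le_norm_sub_add_norm_sub x y z
  have hAL : ‖x - y‖ ≤ Ltri d x y z := le_max_left _ _
  have hBL : ‖y - z‖ ≤ Ltri d x y z := (le_max_left _ _).trans (le_max_right _ _)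
  have hCL : ‖x - z‖ ≤ Ltri d x y z := (le_max_right _ _).trans (le_max_right _ _)
  have ha' : x i - y i ≤ ‖x - y‖ := by simpa using hcoord (x - y)
  have hb' : y i - z i ≤ ‖y - z‖ := by simpa using hcoord (y - z)
  have hsum : x i - z i = (x i - y i) + (y i - z i) := by ring
  rw [permI_eq d n hn]
  simp only [Kker, hcast, PiLp.sub_apply]
  rw [hsum] at hεL ⊢
  rcases le_total (x i - y i) (y i - z i) with h | h
  · exact le_perm_of_le (2 * n - 1) (by omega) hα0 hα1 (sub_nonneg.2 h₁) h ha' hb' hA hB hC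
      htri hBL hCL hε hεL
  · rw [add_comm (x i - y i)] at hεL ⊢
    have := le_perm_of_le (2 * n - 1) (by omega) hα0 hα1 (sub_nonneg.2 h₂) h hb' ha' hB hA hC
      (by linarith) hAL hCL hε hεL
    linarith

lemma le_permI (d n : ℕ) (hn : 1 ≤ n) {α ε : ℝ} (hα0 : 0 < α) (hα1 : α < 1)
    (hε : 0 ≤ ε) (i : Fin d) {x y z : EuclideanSpace ℝ (Fin d)}
    (hxy : x ≠ y) (hyz : y ≠ z) (hxz : x ≠ z)
    (hεL : ε * Ltri d x y z ≤ max |x i - y i| (max |y i - z i| |x i - z i|)) :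
    (1 - (1 / 2 : ℝ) ^ (1 - α)) * (ε / 2) ^ (2 * (2 * n - 1)) / (Ltri d x y z) ^ (2 * α) ≤
      permI d n α i x y z := by
  wlog h₁ : y i ≤ x i generalizing x y
  · rw [← permI_swap_left, ← Ltri_swap_left]
    refine this hxy.symm hxz hyz ?_ (le_of_not_ge h₁)
    rwa [Ltri_swap_left, abs_sub_comm, max_comm |x i - z i|]
  wlog h₂ : z i ≤ y i generalizing x y z
  · have h₂ := le_of_not_ge h₂
    rw [← permI_swap_right, ← Ltri_swap_right]
    rw [← Ltri_swap_right] at hεL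
    rcases le_total (z i) (x i) with h | h
    · refine this hxz hyz.symm hxy ?_ h h₂
      simp only [le_max_iff, abs_sub_comm (z i)] at hεL ⊢
      tauto
    · rw [← permI_swap_left, ← Ltri_swap_left]
      rw [← Ltri_swap_left] at hεL
      refine this hxz.symm hxy hyz.symm ?_ h h₁
      simp only [le_max_iff, abs_sub_comm (z i)] at hεL ⊢
      tauto
  refine le_permI_of_sorted d n hn hα0 hα1 hε i hxy hyz hxz h₁ h₂ (hεL.trans ?_)
  rw [abs_of_nonneg (sub_nonneg.2 h₁), abs_of_nonneg (sub_nonneg.2 h₂),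
    abs_of_nonneg (sub_nonneg.2 (h₂.trans h₁))]
  simp only [max_le_iff]
  refine ⟨?_, ?_, ?_⟩ <;> linarith

lemma exists_norm_le_mul_abs (d : ℕ) (hd : 1 ≤ d) (v : EuclideanSpace ℝ (Fin d)) :
    ∃ i, 1 / (d : ℝ) * ‖v‖ ≤ |v i| := by
  have hd' : (0 : ℝ) < d := by exact_mod_cast hd
  have : Nonempty (Fin d) := ⟨⟨0, hd⟩⟩
  by_contra! h
  have h1 : ‖v‖ ≤ ∑ i, |v i| := by
    rw [EuclideanSpace.norm_eq]
    refine Real.sqrt_le_iff.2 ⟨Finset.sum_nonneg fun _ _ => abs_nonneg _, ?_⟩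
    exact Finset.sum_sq_le_sq_sum_of_nonneg fun i _ => abs_nonneg (v i)
  have h2 : ∑ i, |v i| < ∑ _i : Fin d, 1 / (d : ℝ) * ‖v‖ :=
    Finset.sum_lt_sum_of_nonempty Finset.univ_nonempty fun i _ => h i
  have h3 : ∑ _i : Fin d, 1 / (d : ℝ) * ‖v‖ = ‖v‖ := by
    simp; field_simp
  linarith

lemma exists_Ltri_le_mul_abs (d : ℕ) (hd : 1 ≤ d) (x y z : EuclideanSpace ℝ (Fin d)) :
    ∃ i, 1 / (d : ℝ) * Ltri d x y z ≤ max |x i - y i| (max |y i - z i| |x i - z i|) := by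
  obtain ⟨v, hv, hL⟩ : ∃ v : EuclideanSpace ℝ (Fin d),
      (∀ i, |v i| ≤ max |x i - y i| (max |y i - z i| |x i - z i|)) ∧ Ltri d x y z = ‖v‖ := by
    rcases max_choice ‖x - y‖ (max ‖y - z‖ ‖x - z‖) with h | h
    · exact ⟨x - y, fun i => by simp, h⟩
    · rcases max_choice ‖y - z‖ ‖x - z‖ with h' | h'
      · exact ⟨y - z, fun i => by simp, h.trans h'⟩
      · exact ⟨x - z, fun i => by simp, h.trans h'⟩
  obtain ⟨i, hi⟩ := exists_norm_le_mul_abs d hd v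
  exact ⟨i, hL ▸ hi.trans (hv i)⟩

lemma abs_pow_sub_pow_mul_le (m : ℕ) (hm : 1 ≤ m) {u v C : ℝ} (hu : |u| ≤ C) (hv : |v| ≤ C) :
    |u ^ m - v ^ m| * C ≤ m * |u - v| * C ^ m := by
  have hC : 0 ≤ C := (abs_nonneg u).trans hu
  calc |u ^ m - v ^ m| * C ≤ |u - v| * m * max |u| |v| ^ (m - 1) * C := by
        gcongr; exact abs_pow_sub_pow_le u v m
    _ ≤ |u - v| * m * C ^ (m - 1) * C := by gcongr; exact max_le hu hv
    _ = m * |u - v| * C ^ m := by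
        rw [mul_assoc _ _ C, pow_sub_one_mul (by omega)]; ring

lemma rpow_sub_rpow_le {s B C : ℝ} (hs : 1 ≤ s) (hB : 0 < B) (hC : 0 < C) :
    (C ^ s - B ^ s) * C ≤ s * (C - B) * C ^ s := by
  have h := one_add_mul_self_le_rpow_one_add (s := B / C - 1)
    (by linarith [div_pos hB hC]) hs
  rw [add_sub_cancel, Real.div_rpow hB.le hC.le, le_div_iff₀ (Real.rpow_pos_of_pos hC s)] at h
  have h' := mul_le_mul_of_nonneg_right h hC.le
  have : (1 + s * (B / C - 1)) * C ^ s * C = C ^ s * C - s * (C - B) * C ^ s := by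
    field_simp
    ring
  linarith

/-- Upper bound for the permutation in one coordinate when the sides satisfy `A ≤ B ≤ C`. -/
lemma perm_le (m : ℕ) (hm : 1 ≤ m) {α a b A B C : ℝ} (hα0 : 0 < α) (hα1 : α < 1)
    (haA : |a| ≤ A) (hbB : |b| ≤ B) (hcC : |a + b| ≤ C) (hA : 0 < A)
    (hAB : A ≤ B) (hBC : B ≤ C) (hC : C ≤ A + B) :
    a ^ m / A ^ (m + α) * ((a + b) ^ m / C ^ (m + α)) +
      b ^ m / B ^ (m + α) * ((a + b) ^ m / C ^ (m + α)) -
      a ^ m / A ^ (m + α) * (b ^ m / B ^ (m + α)) ≤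
      (2 * m + α + 1) * 2 ^ α / C ^ (2 * α) := by
  have hB : 0 < B := hA.trans_le hAB
  have hC0 : 0 < C := hB.trans_le hBC
  have hm' : (1 : ℝ) ≤ m := by exact_mod_cast hm
  have hker : ∀ u U : ℝ, 0 < U → |u| ≤ U → |u ^ m / U ^ (m + α)| ≤ 1 / U ^ α := by
    intro u U hU hu
    have hU' := Real.rpow_pos_of_pos hU α
    rw [abs_div, abs_pow, abs_of_pos (Real.rpow_pos_of_pos hU _), Real.rpow_add hU,
      Real.rpow_natCast, div_le_div_iff₀ (by positivity) hU', one_mul]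
    gcongr
  have hBα : 1 / B ^ α ≤ 2 ^ α / C ^ α := by
    rw [div_le_div_iff₀ (Real.rpow_pos_of_pos hB _) (Real.rpow_pos_of_pos hC0 _), one_mul,
      ← Real.mul_rpow two_pos.le hB.le]
    exact Real.rpow_le_rpow hC0.le (by linarith) hα0.le
  have hAs := Real.rpow_pos_of_pos hA α
  have hBs := Real.rpow_pos_of_pos hB (m + α)
  have hCs := Real.rpow_pos_of_pos hC0 (m + α)
  have hCα := Real.rpow_pos_of_pos hC0 α
  have hBα' := Real.rpow_pos_of_pos hB α
  have hdiff : |(a + b) ^ m / C ^ (m + α) - b ^ m / B ^ (m + α)| ≤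
      (2 * m + α) * (A / C) * (2 ^ α / C ^ α) := by
    have h1 : |((a + b) ^ m - b ^ m) / C ^ (m + α)| ≤ m * (A / C) * (1 / C ^ α) := by
      have h := abs_pow_sub_pow_mul_le m hm hcC (hbB.trans hBC)
      rw [add_sub_cancel_right] at h
      rw [abs_div, abs_of_pos hCs, Real.rpow_add hC0, Real.rpow_natCast,
        div_le_iff₀ (by positivity)]
      have : m * (A / C) * (1 / C ^ α) * (C ^ m * C ^ α) = m * A * C ^ m / C := by
        field_simp
      rw [this, le_div_iff₀ hC0]
      exact h.trans (by gcongr)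
    have h2 : |(C ^ (m + α) - B ^ (m + α)) / C ^ (m + α)| ≤ (m + α) * (A / C) := by
      have h := rpow_sub_rpow_le (show (1 : ℝ) ≤ m + α by linarith) hB hC0
      rw [abs_of_nonneg (div_nonneg (sub_nonneg.2
        (Real.rpow_le_rpow hB.le hBC (by linarith))) hCs.le), div_le_iff₀ hCs]
      have : (m + α) * (A / C) * C ^ (m + α) = (m + α) * A * C ^ (m + α) / C := by
        field_simp
      rw [this, le_div_iff₀ hC0]
      refine h.trans ?_
      gcongr
      linarith
    have h3 : (a + b) ^ m / C ^ (m + α) - b ^ m / B ^ (m + α) =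
        ((a + b) ^ m - b ^ m) / C ^ (m + α) -
          b ^ m / B ^ (m + α) * ((C ^ (m + α) - B ^ (m + α)) / C ^ (m + α)) := by
      field_simp
      ring
    have h4 : 1 / C ^ α ≤ 2 ^ α / C ^ α := by
      gcongr
      exact Real.one_le_rpow one_le_two hα0.le
    calc |(a + b) ^ m / C ^ (m + α) - b ^ m / B ^ (m + α)|
        ≤ |((a + b) ^ m - b ^ m) / C ^ (m + α)| +
          |b ^ m / B ^ (m + α)| * |(C ^ (m + α) - B ^ (m + α)) / C ^ (m + α)| := by
          rw [h3, ← abs_mul]; exact abs_sub _ _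
      _ ≤ m * (A / C) * (2 ^ α / C ^ α) + 2 ^ α / C ^ α * ((m + α) * (A / C)) := by
          refine add_le_add (h1.trans (by gcongr)) ?_
          exact mul_le_mul ((hker b B hB hbB).trans hBα) h2 (abs_nonneg _) (by positivity)
      _ = _ := by ring
  have hAα : 1 / A ^ α * (A / C) ≤ 1 / C ^ α := by
    have hpow : ∀ u : ℝ, 0 < u → u / u ^ α = u ^ (1 - α) := fun u hu => by
      rw [Real.rpow_sub hu, Real.rpow_one]
    have h : A / A ^ α ≤ C / C ^ α := by
      rw [hpow A hA, hpow C hC0]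
      exact Real.rpow_le_rpow hA.le (hAB.trans hBC) (by linarith)
    calc 1 / A ^ α * (A / C) = A / A ^ α / C := by ring
      _ ≤ C / C ^ α / C := by gcongr
      _ = 1 / C ^ α := by field_simp
  calc _ = a ^ m / A ^ (m + α) * ((a + b) ^ m / C ^ (m + α) - b ^ m / B ^ (m + α)) +
        b ^ m / B ^ (m + α) * ((a + b) ^ m / C ^ (m + α)) := by ring
    _ ≤ 1 / A ^ α * ((2 * m + α) * (A / C) * (2 ^ α / C ^ α)) +
        2 ^ α / C ^ α * (1 / C ^ α) := by
      refine add_le_add ((le_abs_self _).trans ?_) ((le_abs_self _).trans ?_) <;> rw [abs_mul]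
      · exact mul_le_mul (hker a A hA haA) hdiff (abs_nonneg _) (by positivity)
      · exact mul_le_mul ((hker b B hB hbB).trans hBα) (hker _ C hC0 hcC) (abs_nonneg _)
          (by positivity)
    _ = (2 * m + α) * (2 ^ α / C ^ α) * (1 / A ^ α * (A / C)) +
        2 ^ α / C ^ α * (1 / C ^ α) := by ring
    _ ≤ (2 * m + α) * (2 ^ α / C ^ α) * (1 / C ^ α) + 2 ^ α / C ^ α * (1 / C ^ α) := by gcongr
    _ = (2 * m + α + 1) * 2 ^ α / C ^ (2 * α) := by
      rw [two_mul α, Real.rpow_add hC0]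
      field_simp

/-- The upper bound for points whose mutual distances are sorted. -/
lemma permI_le_of_sorted (d n : ℕ) (hn : 1 ≤ n) {α : ℝ} (hα0 : 0 < α) (hα1 : α < 1)
    (i : Fin d) {x y z : EuclideanSpace ℝ (Fin d)} (hxy : x ≠ y)
    (h₁ : ‖x - y‖ ≤ ‖y - z‖) (h₂ : ‖y - z‖ ≤ ‖x - z‖) :
    permI d n α i x y z ≤
      (2 * (2 * n - 1 : ℕ) + α + 1) * 2 ^ α / (Ltri d x y z) ^ (2 * α) := by
  have hcast : 2 * (n : ℝ) - 1 + α = ((2 * n - 1 : ℕ) : ℝ) + α := by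
    rw [Nat.cast_sub (by omega)]; push_cast; ring
  have hL : Ltri d x y z = ‖x - z‖ := by
    rw [Ltri, max_eq_right h₂, max_eq_right (h₁.trans h₂)]
  have hsum : x i - z i = (x i - y i) + (y i - z i) := by ring
  have hc : |x i - z i| ≤ ‖x - z‖ := by simpa using PiLp.norm_apply_le (x - z) i
  rw [permI_eq d n hn, hL]
  simp only [Kker, hcast, PiLp.sub_apply]
  rw [hsum] at hc ⊢
  exact perm_le (2 * n - 1) (by omega) hα0 hα1
    (by simpa using PiLp.norm_apply_le (x - y) i) (by simpa using PiLp.norm_apply_le (y - z) i)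
    hc (norm_pos_iff.2 (sub_ne_zero.2 hxy)) h₁ h₂ (norm_sub_le_norm_sub_add_norm_sub x y z)

lemma permI_le (d n : ℕ) (hn : 1 ≤ n) {α : ℝ} (hα0 : 0 < α) (hα1 : α < 1)
    (i : Fin d) {x y z : EuclideanSpace ℝ (Fin d)} (hxy : x ≠ y) (hyz : y ≠ z) (hxz : x ≠ z) :
    permI d n α i x y z ≤
      (2 * (2 * n - 1 : ℕ) + α + 1) * 2 ^ α / (Ltri d x y z) ^ (2 * α) := by
  wlog h₂ : ‖y - z‖ ≤ ‖x - z‖ generalizing x y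
  · rw [← permI_swap_left, ← Ltri_swap_left]
    exact this hxy.symm hxz hyz (le_of_not_ge h₂)
  wlog h₁ : ‖x - y‖ ≤ ‖y - z‖ generalizing x y z
  · have h₁ := le_of_not_ge h₁
    rw [← permI_swap_left, ← permI_swap_right, ← Ltri_swap_left, ← Ltri_swap_right]
    rcases le_total ‖x - y‖ ‖x - z‖ with h | h
    · rw [← permI_swap_left, ← Ltri_swap_left]
      refine this hyz.symm hxy.symm hxz.symm ?_ ?_
      · rwa [norm_sub_rev y x, norm_sub_rev z x]
      · rwa [norm_sub_rev z y, norm_sub_rev y x]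
    · refine this hyz hxz.symm hxy.symm ?_ ?_
      · rwa [norm_sub_rev z x, norm_sub_rev y x]
      · rwa [norm_sub_rev z x]
  exact permI_le_of_sorted d n hn hα0 hα1 i hxy h₁ h₂

/-- Corollary: for `0 < α < 1` there are positive constants `A, B` depending only on
`n, d, α` such that for all pairwise distinct `x, y, z ∈ ℝ^d`,
`A / L(x,y,z)^{2α} ≤ p_{α,n}(x,y,z) ≤ B / L(x,y,z)^{2α}`. -/
theorem stmt1 (d n : ℕ) (hd : 1 ≤ d) (hn : 1 ≤ n) (α : ℝ) (hα0 : 0 < α) (hα1 : α < 1) :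
    ∃ A B : ℝ, 0 < A ∧ 0 < B ∧
      ∀ x y z : EuclideanSpace ℝ (Fin d),
        x ≠ y → y ≠ z → x ≠ z →
        A / (Ltri d x y z) ^ (2 * α) ≤ permTot d n α x y z ∧
          permTot d n α x y z ≤ B / (Ltri d x y z) ^ (2 * α) := by
  have hd' : (0 : ℝ) < d := by exact_mod_cast hd
  have hδ : 0 < 1 - (1 / 2 : ℝ) ^ (1 - α) :=
    sub_pos.2 (Real.rpow_lt_one (by norm_num) (by norm_num) (by linarith))
  refine ⟨(1 - (1 / 2 : ℝ) ^ (1 - α)) * (1 / (d : ℝ) / 2) ^ (2 * (2 * n - 1)),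
    d * ((2 * (2 * n - 1 : ℕ) + α + 1) * 2 ^ α), by positivity, by positivity, ?_⟩
  intro x y z hxy hyz hxz
  constructor
  · have hnonneg : ∀ i, 0 ≤ permI d n α i x y z := fun i => by
      have h := le_permI d n hn hα0 hα1 le_rfl i hxy hyz hxz (by simp)
      rwa [zero_div, zero_pow (by omega), mul_zero, zero_div] at h
    obtain ⟨i, hi⟩ := exists_Ltri_le_mul_abs d hd x y z
    exact (le_permI d n hn hα0 hα1 (by positivity) i hxy hyz hxz hi).trans
      (Finset.single_le_sum (fun j _ => hnonneg j) (Finset.mem_univ i))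
  · calc permTot d n α x y z
        ≤ ∑ _i : Fin d, (2 * (2 * n - 1 : ℕ) + α + 1) * 2 ^ α / (Ltri d x y z) ^ (2 * α) :=
          Finset.sum_le_sum fun i _ => permI_le d n hn hα0 hα1 i hxy hyz hxz
      _ = _ := by rw [Finset.sum_const, Finset.card_univ, Fintype.card_fin, nsmul_eq_mul,
          ← mul_div_assoc]
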